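/- Let T be a regular set in k[x_1,…,x_n] and let P and F be any two polynomials. If prem(P, T) = 0 and prem(F, T) = 0, then prem(P + F, T) = 0. -/

import Mathlib

open MvPolynomial

namespace CharSets

variable {n : ℕ} {K : Type*} [Field K]

/-- The coefficient of `x_i ^ d` in `F`, as a polynomial in the remaining variables. -/
noncomputable def coefv (i : Fin n) (d : ℕ) (F : MvPolynomial (Fin n) K) :
    MvPolynomial (Fin n) K :=
  ∑ m ∈ F.support.filter (fun m => m i = d), monomial (Finsupp.erase i m) (F.coeff m)

/-- The leading coefficient of `F` with respect to the variable `x_i`. -/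
noncomputable def lcv (i : Fin n) (F : MvPolynomial (Fin n) K) : MvPolynomial (Fin n) K :=
  coefv i (F.degreeOf i) F

/-- Auxiliary pseudo-division: computes (pseudo-quotient, pseudo-remainder) pairs,
with the first argument as fuel; the total power of the leading coefficient used is
exactly the fuel, so that starting with fuel `max(l - m + 1, 0)` yields the pair
`(Q, R)` of the unique representation `lc(F,x_i)^q • G = Q*F + R` with
`q = max(l - m + 1, 0)` and `deg(R, x_i) < deg(F, x_i)`. -/
noncomputable def pdivAux (i : Fin n) (F : MvPolynomial (Fin n) K) :
    ℕ → MvPolynomial (Fin n) K × MvPolynomial (Fin n) K →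
      MvPolynomial (Fin n) K × MvPolynomial (Fin n) K
  | 0, QR => QR
  | q + 1, QR =>
    if (QR.2).degreeOf i < F.degreeOf i then
      (lcv i F ^ (q + 1) * QR.1, lcv i F ^ (q + 1) * QR.2)
    else
      pdivAux i F q
        (lcv i F * QR.1 +
            coefv i ((QR.2).degreeOf i) QR.2 * X i ^ ((QR.2).degreeOf i - F.degreeOf i),
          lcv i F * QR.2 -
            coefv i ((QR.2).degreeOf i) QR.2 * X i ^ ((QR.2).degreeOf i - F.degreeOf i) * F)

/-- The pseudo-remainder `prem(G, F, x_i)`. -/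
noncomputable def prem (G F : MvPolynomial (Fin n) K) (i : Fin n) : MvPolynomial (Fin n) K :=
  (pdivAux i F (G.degreeOf i + 1 - F.degreeOf i) (0, G)).2

/-- The pseudo-quotient `pquo(G, F, x_i)`. -/
noncomputable def pquo (G F : MvPolynomial (Fin n) K) (i : Fin n) : MvPolynomial (Fin n) K :=
  (pdivAux i F (G.degreeOf i + 1 - F.degreeOf i) (0, G)).1

/-- The class of `P`: the largest index (1-based) of a variable actually occurring in `P`;
the class of a constant is `0`. -/
noncomputable def cls (P : MvPolynomial (Fin n) K) : ℕ :=
  P.vars.sup fun i => (i : ℕ) + 1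

/-- The degree of `G` in the leading variable of `P` (`0` if `P` is constant). -/
noncomputable def degLv (G P : MvPolynomial (Fin n) K) : ℕ :=
  if h : P.vars.Nonempty then G.degreeOf (P.vars.max' h) else 0

/-- `G` is R-reduced with respect to `P`, i.e. `deg(G, lv(P)) < deg(P, lv(P))`. -/
def RReduced (G P : MvPolynomial (Fin n) K) : Prop :=
  degLv G P < degLv P P

/-- The initial of `P`: its leading coefficient w.r.t. its leading variable. -/
noncomputable def ini (P : MvPolynomial (Fin n) K) : MvPolynomial (Fin n) K :=
  if h : P.vars.Nonempty then lcv (P.vars.max' h) P else P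

/-- Pseudo-remainder of `G` w.r.t. `F` in the leading variable of `F`
(in case `F` is constant, `m = 0` and the pseudo-remainder is `0`). -/
noncomputable def premLv (G F : MvPolynomial (Fin n) K) : MvPolynomial (Fin n) K :=
  if h : F.vars.Nonempty then prem G F (F.vars.max' h) else 0

/-- Pseudo-quotient of `G` w.r.t. `F` in the leading variable of `F`. -/
noncomputable def pquoLv (G F : MvPolynomial (Fin n) K) : MvPolynomial (Fin n) K :=
  if h : F.vars.Nonempty then pquo G F (F.vars.max' h) else 0

/-- Iterated pseudo-remainder with respect to a triangular set `[T_1, …, T_r]`: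
`prem(P, T) = prem(⋯prem(P, T_r, lv(T_r)), …, T_1, lv(T_1))`. -/
noncomputable def premTS (P : MvPolynomial (Fin n) K) (L : List (MvPolynomial (Fin n) K)) :
    MvPolynomial (Fin n) K :=
  L.foldr (fun T acc => premLv acc T) P

/-- The Sylvester matrix of `F` and `G` with respect to the variable `x_i`. -/
noncomputable def sylvester (i : Fin n) (F G : MvPolynomial (Fin n) K) :
    Matrix (Fin (G.degreeOf i + F.degreeOf i)) (Fin (G.degreeOf i + F.degreeOf i))
      (MvPolynomial (Fin n) K) :=
  Matrix.of fun r c =>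
    if (r : ℕ) < G.degreeOf i then
      if (r : ℕ) ≤ (c : ℕ) ∧ (c : ℕ) ≤ (r : ℕ) + F.degreeOf i then
        coefv i (F.degreeOf i + (r : ℕ) - (c : ℕ)) F
      else 0
    else
      if (r : ℕ) - G.degreeOf i ≤ (c : ℕ) ∧ (c : ℕ) ≤ (r : ℕ) then
        coefv i (G.degreeOf i + ((r : ℕ) - G.degreeOf i) - (c : ℕ)) G
      else 0

/-- The resultant `res(F, G, x_i)` of `F` and `G` w.r.t. `x_i`
(the determinant of the Sylvester matrix). -/
noncomputable def resv (F G : MvPolynomial (Fin n) K) (i : Fin n) : MvPolynomial (Fin n) K :=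
  (sylvester i F G).det

/-- Resultant of `F` and `G` w.r.t. the leading variable of `G`. -/
noncomputable def resLv (F G : MvPolynomial (Fin n) K) : MvPolynomial (Fin n) K :=
  if h : G.vars.Nonempty then resv F G (G.vars.max' h) else F

/-- Iterated resultant with respect to a triangular set:
`res(F, T) = res(⋯res(F, T_r, lv(T_r)), …, T_1, lv(T_1))`. -/
noncomputable def resTS (F : MvPolynomial (Fin n) K) (L : List (MvPolynomial (Fin n) K)) :
    MvPolynomial (Fin n) K :=
  L.foldr (fun T acc => resLv acc T) F

/-- A triangular set: a nonempty ordered set of nonconstant polynomials with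
strictly increasing classes. -/
def TriangularSet (L : List (MvPolynomial (Fin n) K)) : Prop :=
  L ≠ [] ∧ (∀ T ∈ L, 0 < cls T) ∧ L.Chain' fun A B => cls A < cls B

/-- An ascending set: either a single nonzero constant, or a triangular set in which
every later element is R-reduced with respect to every earlier one. -/
def AscendingSet (L : List (MvPolynomial (Fin n) K)) : Prop :=
  (∃ a : K, a ≠ 0 ∧ L = [MvPolynomial.C a]) ∨
    (TriangularSet L ∧ L.Pairwise fun A B => RReduced B A)

/-- `F` has lower rank than `G`. -/
def rkLT (F G : MvPolynomial (Fin n) K) : Prop :=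
  cls F < cls G ∨ (cls F = cls G ∧ 0 < cls F ∧ degLv F F < degLv G G)

/-- `F` and `G` have the same rank: neither has lower rank than the other. -/
def rkEQ (F G : MvPolynomial (Fin n) K) : Prop :=
  ¬ rkLT F G ∧ ¬ rkLT G F

/-- `B` has lower rank than `A` (as ascending sets). -/
def ascLT (B A : List (MvPolynomial (Fin n) K)) : Prop :=
  (∃ j, j < min A.length B.length ∧
      (∀ i, i < j → rkEQ (A.getD i 0) (B.getD i 0)) ∧ rkLT (B.getD j 0) (A.getD j 0)) ∨
    (A.length < B.length ∧ ∀ i, i < A.length → rkEQ (A.getD i 0) (B.getD i 0))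

/-- A Ritt characteristic set of the ideal `I`: an ascending set contained in `I`
of minimal rank among all ascending sets contained in `I`. -/
def RittCharSet (I : Ideal (MvPolynomial (Fin n) K)) (A : List (MvPolynomial (Fin n) K)) :
    Prop :=
  AscendingSet A ∧ (∀ a ∈ A, a ∈ I) ∧
    ∀ B : List (MvPolynomial (Fin n) K), AscendingSet B → (∀ b ∈ B, b ∈ I) → ¬ ascLT B A

/-- The saturated ideal of a triangular set, as a set of polynomials. -/
def satTS (L : List (MvPolynomial (Fin n) K)) : Set (MvPolynomial (Fin n) K) :=
  {F | ∃ q : ℕ, 0 < q ∧ (L.map ini).prod ^ q * F ∈ Ideal.span {T | T ∈ L}}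

/-- A regular set: a triangular set such that `res(ini(T_j), [T_1, …, T_{j-1}]) ≠ 0`
for `j = 2, …, r`. -/
def RegularSet (L : List (MvPolynomial (Fin n) K)) : Prop :=
  TriangularSet L ∧
    ∀ j : ℕ, 0 < j → j < L.length → resTS (ini (L.getD j 0)) (L.take j) ≠ 0

/-- A normal triangular set: `deg(ini(T_j), lv(T_i)) = 0` for all `i < j`. -/
def NormalSet (L : List (MvPolynomial (Fin n) K)) : Prop :=
  TriangularSet L ∧ L.Pairwise fun A B => degLv (ini B) A = 0

/-- The purely lexicographical order on monomials determined by `x_1 < ⋯ < x_n`. -/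
def plexLT (a b : Fin n →₀ ℕ) : Prop :=
  ∃ k : Fin n, a k < b k ∧ ∀ j : Fin n, k < j → a j = b j

/-- `m` is the leading monomial of `P` w.r.t. the plex order. -/
def IsLpp (P : MvPolynomial (Fin n) K) (m : Fin n →₀ ℕ) : Prop :=
  m ∈ P.support ∧ ∀ m' ∈ P.support, m' ≠ m → plexLT m' m

/-- `G` is the reduced (Buchberger–)Gröbner basis of the ideal `I` w.r.t. the plex
term order determined by `x_1 < ⋯ < x_n`: its elements are nonzero monic members of `I`,
the leading monomial of every nonzero member of `I` is divisible by the leading monomial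
of some element of `G`, every element of `G` is B-reduced w.r.t. the others, and `G`
generates `I`. -/
def IsReducedGB (I : Ideal (MvPolynomial (Fin n) K)) (G : Finset (MvPolynomial (Fin n) K)) :
    Prop :=
  (∀ g ∈ G, g ∈ I ∧ g ≠ 0 ∧ ∀ m, IsLpp g m → g.coeff m = 1) ∧
    (∀ F ∈ I, F ≠ 0 → ∃ g ∈ G, ∃ mg mF, IsLpp g mg ∧ IsLpp F mF ∧ mg ≤ mF) ∧
    (∀ g ∈ G, ∀ g' ∈ G, g' ≠ g → ∀ m ∈ g.support, ∀ m', IsLpp g' m' → ¬ m' ≤ m) ∧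
    Ideal.span (G : Set (MvPolynomial (Fin n) K)) = I

/-- `Cs` is the W-characteristic set of `I`: the minimal triangular set contained in the
reduced plex Gröbner basis `G` of `I`, i.e. for each class realized in `G`, `Cs` contains
the element of that class whose leading monomial is minimal w.r.t. the plex order, the
elements being ordered by increasing class (equivalently, by the plex order). -/
def IsWCharSet (I : Ideal (MvPolynomial (Fin n) K)) (Cs : List (MvPolynomial (Fin n) K)) :
    Prop :=
  ∃ G : Finset (MvPolynomial (Fin n) K), IsReducedGB I G ∧
    (Cs.Chain' fun A B => cls A < cls B) ∧
    (∀ c ∈ Cs, c ∈ G) ∧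
    (∀ g ∈ G, ∃ c ∈ Cs, cls c = cls g) ∧
    ∀ c ∈ Cs, ∀ g ∈ G, cls g = cls c → g ≠ c →
      ∃ mc mg, IsLpp c mc ∧ IsLpp g mg ∧ plexLT mc mg

/-- The set of common zeros of a set `S` of polynomials over `k`, taken in `Kc ^ n`
for an extension `Kc` of `k`. -/
def zeroSet {k : Type*} [Field k] (Kc : Type*) [CommRing Kc] [Algebra k Kc]
    (S : Set (MvPolynomial (Fin n) k)) : Set (Fin n → Kc) :=
  {a | ∀ p ∈ S, MvPolynomial.aeval a p = 0}


theorem coefv_mem_supported {s : Set (Fin n)} (i : Fin n) (d : ℕ) {F : MvPolynomial (Fin n) K}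
    (hF : F ∈ supported K s) : coefv i d F ∈ supported K (s \ {i}) := by
  classical
  refine Subalgebra.sum_mem _ fun m hm => ?_
  rw [mem_supported]
  intro j hj
  rw [Finset.mem_coe, vars_monomial (mem_support_iff.1 (Finset.mem_filter.1 hm).1),
    Finsupp.support_erase, Finset.mem_erase] at hj
  exact ⟨mem_supported.1 hF (Finset.mem_coe.2 ((mem_vars_iff_mem_support j).2
    ⟨m, (Finset.mem_filter.1 hm).1, hj.2⟩)), hj.1⟩

theorem degreeOf_eq_zero_of_mem_supported {s : Set (Fin n)} {i : Fin n} (hi : i ∉ s)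
    {F : MvPolynomial (Fin n) K} (hF : F ∈ supported K s) : F.degreeOf i = 0 := by
  by_contra h
  exact hi (mem_supported.1 hF (Finset.mem_coe.2 (mem_vars_iff_degreeOf_ne_zero.2 h)))

/-- View a multivariate polynomial as a univariate polynomial in `x_i`, with coefficients in the
same ring of multivariate polynomials. -/
noncomputable def toUni (i : Fin n) :
    MvPolynomial (Fin n) K →ₐ[K] Polynomial (MvPolynomial (Fin n) K) :=
  aeval fun j => if j = i then Polynomial.X else Polynomial.C (X j)

theorem toUni_of_mem_supported {s : Set (Fin n)} {i : Fin n} (hi : i ∉ s)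
    {F : MvPolynomial (Fin n) K} (hF : F ∈ supported K s) : toUni i F = Polynomial.C F := by
  have h : (toUni i : MvPolynomial (Fin n) K →ₐ[K] _).toRingHom F =
      (Polynomial.C : MvPolynomial (Fin n) K →+* _) F := by
    refine hom_congr_vars (p₁ := F) (p₂ := F) ?_ ?_ rfl
    · ext c
      simp [toUni, Polynomial.algebraMap_apply]
    · intro j hj _
      have : j ≠ i := by
        rintro rfl
        exact hi (mem_supported.1 hF hj)
      simp [toUni, this]
  exact h

theorem toUni_monomial (i : Fin n) (m : Fin n →₀ ℕ) (c : K) :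
    toUni i (monomial m c) =
      Polynomial.C (monomial (Finsupp.erase i m) c) * Polynomial.X ^ m i := by
  have h : monomial m c = monomial (Finsupp.erase i m) c * X i ^ m i := by
    rw [X_pow_eq_monomial, monomial_mul, mul_one, Finsupp.erase_add_single]
  have hs : monomial (Finsupp.erase i m) c ∈ supported K ({i}ᶜ : Set (Fin n)) := by
    classical
    rw [mem_supported]
    intro j hj
    obtain ⟨e, he, hje⟩ := (mem_vars_iff_mem_support j).1 hj
    obtain rfl := Finset.mem_singleton.1 (support_monomial_subset he)
    rw [Finsupp.support_erase, Finset.mem_erase] at hje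
    exact hje.1
  conv_lhs => rw [h]
  rw [map_mul, map_pow, toUni_of_mem_supported (by simp) hs]
  simp [toUni]

theorem coeff_toUni (i : Fin n) (d : ℕ) (F : MvPolynomial (Fin n) K) :
    (toUni i F).coeff d = coefv i d F := by
  conv_lhs => rw [F.as_sum]
  simp only [map_sum, toUni_monomial, Polynomial.finsetSum_coeff, Polynomial.coeff_C_mul_X_pow]
  rw [coefv, Finset.sum_filter]
  simp only [eq_comm]

theorem eval_toUni (i : Fin n) (F : MvPolynomial (Fin n) K) :
    (toUni i F).eval (X i) = F := by
  have h : (((Polynomial.aeval (X i : MvPolynomial (Fin n) K)).restrictScalars K).comp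
      (toUni i)) = AlgHom.id K _ := by
    ext j
    by_cases hj : j = i <;> simp [toUni, hj]
  have := DFunLike.congr_fun h F
  simpa [Polynomial.coe_aeval_eq_eval] using this

theorem eq_sum_coefv (i : Fin n) (F : MvPolynomial (Fin n) K) {N : ℕ}
    (hN : (toUni i F).natDegree < N) : F = ∑ d ∈ Finset.range N, coefv i d F * X i ^ d := by
  conv_lhs => rw [← eval_toUni i F, Polynomial.eval_eq_sum_range' hN]
  simp only [coeff_toUni]

theorem degreeOf_coefv (i : Fin n) (d : ℕ) (F : MvPolynomial (Fin n) K) :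
    (coefv i d F).degreeOf i = 0 :=
  degreeOf_eq_zero_of_mem_supported (s := Set.univ \ {i}) (by simp)
    (coefv_mem_supported i d (by simp))

theorem toUni_coefv (i : Fin n) (d : ℕ) (F : MvPolynomial (Fin n) K) :
    toUni i (coefv i d F) = Polynomial.C (coefv i d F) :=
  toUni_of_mem_supported (s := Set.univ \ {i}) (by simp)
    (coefv_mem_supported i d (by simp))

theorem natDegree_toUni (i : Fin n) (F : MvPolynomial (Fin n) K) :
    (toUni i F).natDegree = F.degreeOf i := by
  apply le_antisymm
  · rw [Polynomial.natDegree_le_iff_coeff_eq_zero]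
    intro d hd
    rw [coeff_toUni, coefv]
    refine Finset.sum_eq_zero fun m hm => ?_
    rw [Finset.mem_filter] at hm
    have := monomial_le_degreeOf i hm.1
    omega
  · conv_lhs => rw [eq_sum_coefv i F (Nat.lt_succ_self _)]
    refine (degreeOf_sum_le _ _ _).trans (Finset.sup_le fun d hd => ?_)
    refine (degreeOf_mul_le _ _ _).trans ?_
    rw [degreeOf_coefv, zero_add]
    refine (degreeOf_pow_le _ _ _).trans ?_
    rw [degreeOf_X_self, mul_one]
    exact Nat.lt_succ_iff.1 (Finset.mem_range.1 hd)

theorem leadingCoeff_toUni (i : Fin n) (F : MvPolynomial (Fin n) K) :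
    (toUni i F).leadingCoeff = lcv i F := by
  rw [Polynomial.leadingCoeff, natDegree_toUni, coeff_toUni, lcv]

theorem lcv_ne_zero (i : Fin n) {F : MvPolynomial (Fin n) K} (hF : F ≠ 0) : lcv i F ≠ 0 := by
  rw [← leadingCoeff_toUni, Polynomial.leadingCoeff_ne_zero]
  intro h
  exact hF (by rw [← eval_toUni i F, h, Polynomial.eval_zero])

theorem degreeOf_pdiv_step (i : Fin n) (F R : MvPolynomial (Fin n) K)
    (hF : 0 < F.degreeOf i) (hR : F.degreeOf i ≤ R.degreeOf i) :
    (lcv i F * R - coefv i (R.degreeOf i) R * X i ^ (R.degreeOf i - F.degreeOf i) * F).degreeOf i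
      < R.degreeOf i := by
  have hle : (lcv i F * R - coefv i (R.degreeOf i) R *
      X i ^ (R.degreeOf i - F.degreeOf i) * F).degreeOf i ≤ R.degreeOf i - 1 := by
    rw [← natDegree_toUni, Polynomial.natDegree_le_iff_coeff_eq_zero]
    intro d hd
    have hX : toUni i (X i : MvPolynomial (Fin n) K) = Polynomial.X := by simp [toUni]
    rw [map_sub, map_mul, map_mul, map_mul, map_pow, hX, toUni_coefv,
      show toUni i (lcv i F) = Polynomial.C (lcv i F) from toUni_coefv i _ F,
      mul_assoc, Polynomial.coeff_sub, Polynomial.coeff_C_mul, Polynomial.coeff_C_mul,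
      Polynomial.coeff_X_pow_mul', if_pos (by omega)]
    rcases (show R.degreeOf i ≤ d by omega).eq_or_lt with rfl | hlt
    · rw [Nat.sub_sub_self hR, coeff_toUni, coeff_toUni, ← lcv, ← lcv]
      ring
    · rw [Polynomial.coeff_eq_zero_of_natDegree_lt (by rwa [natDegree_toUni]),
        Polynomial.coeff_eq_zero_of_natDegree_lt (p := toUni i F)
          (by rw [natDegree_toUni]; omega)]
      simp
  omega

theorem pdivAux_spec (i : Fin n) (F : MvPolynomial (Fin n) K) (hF : 0 < F.degreeOf i) (q : ℕ)
    (QR : MvPolynomial (Fin n) K × MvPolynomial (Fin n) K)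
    (hq : QR.2.degreeOf i + 1 - F.degreeOf i ≤ q) :
    (pdivAux i F q QR).2.degreeOf i < F.degreeOf i ∧
      ∃ A, lcv i F ^ q * QR.2 = A * F + (pdivAux i F q QR).2 := by
  induction q generalizing QR with
  | zero => exact ⟨by rw [pdivAux]; omega, 0, by simp [pdivAux]⟩
  | succ q ih =>
    rw [pdivAux]
    split_ifs with h
    · refine ⟨?_, 0, by simp⟩
      refine (degreeOf_mul_le _ _ _).trans_lt ?_
      have := degreeOf_pow_le i (lcv i F) (q + 1)
      rw [show (lcv i F).degreeOf i = 0 from degreeOf_coefv i _ F] at this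
      omega
    · have hdeg := degreeOf_pdiv_step i F QR.2 hF (not_lt.1 h)
      obtain ⟨h1, A, hA⟩ := ih (lcv i F * QR.1 +
          coefv i ((QR.2).degreeOf i) QR.2 * X i ^ ((QR.2).degreeOf i - F.degreeOf i),
          lcv i F * QR.2 -
            coefv i ((QR.2).degreeOf i) QR.2 * X i ^ ((QR.2).degreeOf i - F.degreeOf i) * F)
          (by simp only; omega)
      refine ⟨h1, A + lcv i F ^ q * (coefv i ((QR.2).degreeOf i) QR.2 *
        X i ^ ((QR.2).degreeOf i - F.degreeOf i)), ?_⟩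
      simp only at hA
      linear_combination hA

theorem degreeOf_prem_lt (i : Fin n) {F : MvPolynomial (Fin n) K} (hF : 0 < F.degreeOf i)
    (G : MvPolynomial (Fin n) K) : (prem G F i).degreeOf i < F.degreeOf i :=
  (pdivAux_spec i F hF _ (0, G) le_rfl).1

theorem exists_lcv_pow_mul_eq (i : Fin n) {F : MvPolynomial (Fin n) K} (hF : 0 < F.degreeOf i)
    (G : MvPolynomial (Fin n) K) : ∃ q A, lcv i F ^ q * G = A * F + prem G F i :=
  ⟨_, (pdivAux_spec i F hF _ (0, G) le_rfl).2⟩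

theorem sylvester_mem_supported {s : Set (Fin n)} (i : Fin n) {F G : MvPolynomial (Fin n) K}
    (hF : F ∈ supported K s) (hG : G ∈ supported K s) (a b) :
    sylvester i F G a b ∈ supported K (s \ {i}) := by
  rw [sylvester, Matrix.of_apply]
  split_ifs
  · exact coefv_mem_supported i _ hF
  · exact Subalgebra.zero_mem _
  · exact coefv_mem_supported i _ hG
  · exact Subalgebra.zero_mem _

theorem resv_mem_supported {s : Set (Fin n)} (i : Fin n) {F G : MvPolynomial (Fin n) K}
    (hF : F ∈ supported K s) (hG : G ∈ supported K s) :
    resv F G i ∈ supported K (s \ {i}) := by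
  rw [resv, Matrix.det_apply]
  refine Subalgebra.sum_mem _ fun σ _ => ?_
  rw [Units.smul_def]
  exact zsmul_mem (Subalgebra.prod_mem _ fun j _ => sylvester_mem_supported i hF hG _ _) _

theorem sum_shifted_coefv (i : Fin n) (F : MvPolynomial (Fin n) K) {N r : ℕ}
    (hr : r + F.degreeOf i < N) :
    ∑ c : Fin N, (if r ≤ (c : ℕ) ∧ (c : ℕ) ≤ r + F.degreeOf i then
        coefv i (F.degreeOf i + r - c) F else 0) * X i ^ (N - 1 - c) =
      X i ^ (N - 1 - r - F.degreeOf i) * F := by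
  rw [Fin.sum_univ_eq_sum_range (fun c => (if r ≤ c ∧ c ≤ r + F.degreeOf i then
        coefv i (F.degreeOf i + r - c) F else 0) * X i ^ (N - 1 - c)) N]
  have hF := eq_sum_coefv i F (N := F.degreeOf i + 1) (by rw [natDegree_toUni]; omega)
  generalize F.degreeOf i = m at hr hF ⊢
  conv_rhs => rw [hF, Finset.mul_sum]
  simp only [ite_mul, zero_mul]
  rw [← Finset.sum_filter]
  refine Finset.sum_bij' (fun c _ => m + r - c) (fun d _ => m + r - d)
    ?_ ?_ ?_ ?_ ?_
  · intro c hc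
    simp only [Finset.mem_filter, Finset.mem_range] at hc ⊢
    omega
  · intro d hd
    simp only [Finset.mem_filter, Finset.mem_range] at hd ⊢
    omega
  · intro c hc
    simp only [Finset.mem_filter, Finset.mem_range] at hc
    omega
  · intro d hd
    simp only [Finset.mem_range] at hd
    omega
  · intro c hc
    simp only [Finset.mem_filter, Finset.mem_range] at hc
    rw [show N - 1 - c = (N - 1 - r - m) + (m + r - c) by omega, pow_add]
    ring

theorem resv_mem_span (i : Fin n) (F : MvPolynomial (Fin n) K) {G : MvPolynomial (Fin n) K}
    (hG : 0 < G.degreeOf i) : resv F G i ∈ Ideal.span {F, G} := by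
  set N := G.degreeOf i + F.degreeOf i with hN
  have hNpos : 0 < N := by omega
  let v : Fin N → MvPolynomial (Fin n) K := fun c => X i ^ (N - 1 - c)
  have hrow : ∀ r, (sylvester i F G).mulVec v r ∈ Ideal.span {F, G} := by
    intro r
    have hr := r.2
    simp only [Matrix.mulVec, dotProduct, sylvester, Matrix.of_apply, v]
    by_cases h : (r : ℕ) < G.degreeOf i
    · simp only [h, if_true]
      rw [sum_shifted_coefv i F (by omega)]
      exact Ideal.mul_mem_left _ _ (Ideal.subset_span (by simp))
    · simp only [h, if_false]
      have := sum_shifted_coefv i G (N := N) (r := r - G.degreeOf i) (by omega)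
      rw [Nat.sub_add_cancel (not_lt.1 h)] at this
      rw [this]
      exact Ideal.mul_mem_left _ _ (Ideal.subset_span (by simp))
  have hadj : (sylvester i F G).det • v =
      (sylvester i F G).adjugate.mulVec ((sylvester i F G).mulVec v) := by
    rw [Matrix.mulVec_mulVec, Matrix.adjugate_mul, Matrix.smul_mulVec, Matrix.one_mulVec]
  have hlast := congrFun hadj ⟨N - 1, by omega⟩
  simp only [Pi.smul_apply, smul_eq_mul, v, Nat.sub_self, pow_zero, mul_one] at hlast
  rw [resv, hlast, Matrix.mulVec, dotProduct]
  exact Ideal.sum_mem _ fun j _ => Ideal.mul_mem_left _ _ (hrow j)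

theorem exists_leading_var {T : MvPolynomial (Fin n) K} (hT : 0 < cls T) :
    ∃ i : Fin n, cls T = i + 1 ∧ 0 < T.degreeOf i ∧ ini T = lcv i T ∧
      (∀ P, premLv P T = prem P T i) ∧ ∀ P, resLv P T = resv P T i := by
  have h : T.vars.Nonempty := by
    by_contra h
    rw [Finset.not_nonempty_iff_eq_empty] at h
    simp [cls, h] at hT
  refine ⟨T.vars.max' h, le_antisymm ?_ ?_, ?_, by simp [ini, h], fun P => by simp [premLv, h],
    fun P => by simp [resLv, h]⟩
  · refine Finset.sup_le fun j hj => ?_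
    have : j ≤ T.vars.max' h := Finset.le_max' _ _ hj
    have : (j : ℕ) ≤ T.vars.max' h := this
    omega
  · exact Finset.le_sup (f := fun i : Fin n => (i : ℕ) + 1) (T.vars.max'_mem h)
  · exact Nat.pos_of_ne_zero (mem_vars_iff_degreeOf_ne_zero.1 (T.vars.max'_mem h))

theorem lt_cls_of_mem_vars {T : MvPolynomial (Fin n) K} {j : Fin n} (hj : j ∈ T.vars) :
    (j : ℕ) < cls T :=
  Finset.le_sup (f := fun i : Fin n => (i : ℕ) + 1) hj

theorem resTS_mem_span (L : List (MvPolynomial (Fin n) K)) (hL : ∀ T ∈ L, 0 < cls T)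
    (P : MvPolynomial (Fin n) K) : resTS P L ∈ Ideal.span (insert P {T | T ∈ L}) := by
  induction L with
  | nil => exact Ideal.subset_span (by simp [resTS])
  | cons T L ih =>
    obtain ⟨i, -, hdeg, -, -, hres⟩ := exists_leading_var (hL T (by simp))
    have hih := ih fun S hS => hL S (by simp [hS])
    rw [resTS, List.foldr_cons, hres]
    refine Ideal.span_le.2 ?_ (resv_mem_span i _ hdeg)
    rintro x (rfl | rfl)
    · exact Ideal.span_mono (Set.insert_subset_insert fun S hS => by simp_all) hih
    · exact Ideal.subset_span (by simp)

/-- The leading variables of the elements of `L`. -/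
def leadVars (L : List (MvPolynomial (Fin n) K)) : Set (Fin n) :=
  {v | ∃ T ∈ L, cls T = v + 1}

/-- `V` consists of the leading variables of `L` and of variables larger than all of these. -/
def Dominates (V : Set (Fin n)) (L : List (MvPolynomial (Fin n) K)) : Prop :=
  leadVars L ⊆ V ∧ ∀ v ∈ V, v ∈ leadVars L ∨ ∀ T ∈ L, cls T < v + 1

theorem leadVars_append_singleton (L : List (MvPolynomial (Fin n) K))
    {T : MvPolynomial (Fin n) K} {i : Fin n} (hi : cls T = i + 1) :
    leadVars (L ++ [T]) = insert i (leadVars L) := by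
  ext v
  simp only [leadVars, List.mem_append, List.mem_singleton, Set.mem_ofPred_eq, Set.mem_insert_iff,
    Fin.ext_iff]
  constructor
  · rintro ⟨S, hS | rfl, h⟩
    · exact Or.inr ⟨S, hS, h⟩
    · left; omega
  · rintro (h | ⟨S, hS, h⟩)
    · exact ⟨T, Or.inr rfl, by omega⟩
    · exact ⟨S, Or.inl hS, h⟩

theorem Dominates.of_append_singleton {V : Set (Fin n)} {L : List (MvPolynomial (Fin n) K)}
    {T : MvPolynomial (Fin n) K} (hpos : 0 < cls T) (hlt : ∀ S ∈ L, cls S < cls T)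
    (h : Dominates V (L ++ [T])) : Dominates V L := by
  obtain ⟨i, hi, -⟩ := exists_leading_var hpos
  rw [Dominates, leadVars_append_singleton L hi] at h
  refine ⟨(Set.subset_insert _ _).trans h.1, fun v hv => ?_⟩
  rcases h.2 v hv with (rfl | h') | h'
  · exact Or.inr fun S hS => hi ▸ hlt S hS
  · exact Or.inl h'
  · exact Or.inr fun S hS => h' S (by simp [hS])

theorem Dominates.mem_supported {V : Set (Fin n)} {L : List (MvPolynomial (Fin n) K)}
    (h : Dominates V L) {T : MvPolynomial (Fin n) K} (hT : T ∈ L) :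
    T ∈ supported K (Vᶜ ∪ leadVars L) := by
  rw [MvPolynomial.mem_supported]
  intro v hv
  by_cases hV : v ∈ V
  · refine Or.inr ((h.2 v hV).resolve_right fun h' => ?_)
    have := lt_cls_of_mem_vars hv
    have := h' T hT
    omega
  · exact Or.inl hV

theorem insert_diff_subset (V s : Set (Fin n)) (i : Fin n) :
    (V ∪ insert i s) \ {i} ⊆ V ∪ s := by
  rintro v ⟨hv | rfl | hv, hne⟩
  · exact Or.inl hv
  · exact absurd rfl hne
  · exact Or.inr hv

theorem resTS_mem_supported {V : Set (Fin n)} (L : List (MvPolynomial (Fin n) K))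
    (hL : ∀ T ∈ L, 0 < cls T) (hpw : L.Pairwise fun A B => cls A < cls B) (hV : Dominates V L)
    {P : MvPolynomial (Fin n) K} (hP : P ∈ supported K (Vᶜ ∪ leadVars L)) :
    resTS P L ∈ supported K Vᶜ := by
  induction L using List.reverseRecOn generalizing P with
  | nil => simpa [resTS, leadVars] using hP
  | append_singleton L T ih =>
    obtain ⟨i, hi, -, -, -, hres⟩ := exists_leading_var (hL T (by simp))
    rw [List.pairwise_append] at hpw
    have hlt : ∀ S ∈ L, cls S < cls T := fun S hS => hpw.2.2 S hS T (by simp)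
    rw [resTS, List.foldr_append]
    refine ih (fun S hS => hL S (by simp [hS])) hpw.1
      (hV.of_append_singleton (hL T (by simp)) hlt) ?_
    rw [List.foldr_cons, List.foldr_nil, hres]
    have hT := hV.mem_supported (T := T) (by simp)
    rw [leadVars_append_singleton L hi] at hP hT
    exact supported_mono (insert_diff_subset _ _ i) (resv_mem_supported i hP hT)

/-- The saturation of the ideal generated by `L` by the nonzero polynomials in which no variable
of `V` occurs. -/
def paramSat (V : Set (Fin n)) (L : List (MvPolynomial (Fin n) K)) :
    Ideal (MvPolynomial (Fin n) K) where
  carrier := {P | ∃ d ∈ supported K Vᶜ, d ≠ 0 ∧ d * P ∈ Ideal.span {T | T ∈ L}}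
  zero_mem' := ⟨1, Subalgebra.one_mem _, one_ne_zero, by simp⟩
  add_mem' := by
    rintro P Q ⟨d, hd, hd0, hdP⟩ ⟨e, he, he0, heQ⟩
    refine ⟨d * e, Subalgebra.mul_mem _ hd he, mul_ne_zero hd0 he0, ?_⟩
    rw [show d * e * (P + Q) = e * (d * P) + d * (e * Q) by ring]
    exact Ideal.add_mem _ (Ideal.mul_mem_left _ _ hdP) (Ideal.mul_mem_left _ _ heQ)
  smul_mem' := by
    rintro c P ⟨d, hd, hd0, hdP⟩
    refine ⟨d, hd, hd0, ?_⟩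
    rw [smul_eq_mul, mul_left_comm]
    exact Ideal.mul_mem_left _ _ hdP

theorem mem_paramSat {V : Set (Fin n)} {L : List (MvPolynomial (Fin n) K)}
    {P : MvPolynomial (Fin n) K} :
    P ∈ paramSat V L ↔ ∃ d ∈ supported K Vᶜ, d ≠ 0 ∧ d * P ∈ Ideal.span {T | T ∈ L} :=
  Iff.rfl

theorem span_le_paramSat (V : Set (Fin n)) (L : List (MvPolynomial (Fin n) K)) :
    Ideal.span {T | T ∈ L} ≤ paramSat V L := fun P hP =>
  ⟨1, Subalgebra.one_mem _, one_ne_zero, by simpa using hP⟩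

theorem paramSat_mono (V : Set (Fin n)) {L M : List (MvPolynomial (Fin n) K)} (h : L ⊆ M) :
    paramSat V L ≤ paramSat V M := by
  rintro P ⟨d, hd, hd0, hdP⟩
  exact ⟨d, hd, hd0, Ideal.span_mono (fun T hT => h hT) hdP⟩

theorem mem_paramSat_of_mul_mem {V : Set (Fin n)} {L : List (MvPolynomial (Fin n) K)}
    {r P : MvPolynomial (Fin n) K} (hr : r ∈ supported K Vᶜ) (hr0 : r ≠ 0)
    (h : r * P ∈ paramSat V L) : P ∈ paramSat V L := by
  obtain ⟨d, hd, hd0, hdP⟩ := h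
  exact ⟨d * r, Subalgebra.mul_mem _ hd hr, mul_ne_zero hd0 hr0, by rwa [mul_assoc]⟩

theorem mem_paramSat_of_mul_mem_of_mem_span {V : Set (Fin n)}
    {L : List (MvPolynomial (Fin n) K)} {r c a : MvPolynomial (Fin n) K}
    (hr : r ∈ supported K Vᶜ) (hr0 : r ≠ 0) (hrc : r ∈ Ideal.span (insert c {T | T ∈ L}))
    (h : c * a ∈ paramSat V L) : a ∈ paramSat V L := by
  obtain ⟨b, z, hz, rfl⟩ := Ideal.mem_span_insert.1 hrc
  refine mem_paramSat_of_mul_mem hr hr0 ?_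
  rw [add_mul, mul_assoc]
  exact Ideal.add_mem _ (Ideal.mul_mem_left _ _ h)
    (Ideal.mul_mem_right _ _ (span_le_paramSat V L hz))

theorem coefv_mem_paramSat {V : Set (Fin n)} {L : List (MvPolynomial (Fin n) K)} {i : Fin n}
    (hi : i ∈ V) (hL : ∀ T ∈ L, T ∈ supported K ({i}ᶜ : Set (Fin n)))
    {P : MvPolynomial (Fin n) K} (hP : P ∈ paramSat V L) (d : ℕ) :
    coefv i d P ∈ paramSat V L := by
  obtain ⟨e, he, he0, heP⟩ := hP
  refine ⟨e, he, he0, ?_⟩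
  have hmap : toUni i (e * P) ∈ (Ideal.span {T | T ∈ L}).map Polynomial.C := by
    have := Ideal.mem_map_of_mem (toUni i) heP
    rw [Ideal.map_span] at this ⊢
    refine Ideal.span_mono ?_ this
    rintro _ ⟨T, hT, rfl⟩
    exact ⟨T, hT, (toUni_of_mem_supported (by simp) (hL T hT)).symm⟩
  have := Ideal.mem_map_C_iff.1 hmap d
  rwa [map_mul, toUni_of_mem_supported (s := Vᶜ) (by simpa using hi) he,
    Polynomial.coeff_C_mul, coeff_toUni] at this

theorem mem_of_sub_mul_mem_of_degreeOf_lt {J : Ideal (MvPolynomial (Fin n) K)} {i : Fin n}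
    (hJ : ∀ P ∈ J, ∀ d, coefv i d P ∈ J) {T R A : MvPolynomial (Fin n) K}
    (hT : ∀ a, lcv i T * a ∈ J → a ∈ J) (hR : R.degreeOf i < T.degreeOf i)
    (h : R - A * T ∈ J) : R ∈ J := by
  let ψ := (Polynomial.mapRingHom (Ideal.Quotient.mk J)).comp (toUni i).toRingHom
  have hcoeff : ∀ P d, (ψ P).coeff d = Ideal.Quotient.mk J (coefv i d P) := fun P d => by
    simp [ψ, coeff_toUni]
  have hψ : ∀ P, ψ P = 0 ↔ P ∈ J := by
    refine fun P => ⟨fun hP => ?_, fun hP => ?_⟩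
    · rw [eq_sum_coefv i P (Nat.lt_succ_self _)]
      refine Ideal.sum_mem _ fun d _ => Ideal.mul_mem_right _ _ ?_
      rw [← Ideal.Quotient.eq_zero_iff_mem, ← hcoeff, hP, Polynomial.coeff_zero]
    · ext d
      rw [hcoeff, Polynomial.coeff_zero, Ideal.Quotient.eq_zero_iff_mem]
      exact hJ P hP d
  have hdeg : ∀ P, (ψ P).natDegree ≤ P.degreeOf i := fun P => by
    rw [← natDegree_toUni]
    exact Polynomial.natDegree_map_le
  have hmul : ψ R = ψ A * ψ T := by
    rw [← map_mul, ← sub_eq_zero, ← map_sub, hψ]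
    exact h
  rw [← hψ]
  by_contra hne
  have hA : ψ A ≠ 0 := fun hA => hne (by rw [hmul, hA, zero_mul])
  have hlc : (ψ A).leadingCoeff * Ideal.Quotient.mk J (lcv i T) ≠ 0 := by
    rw [Polynomial.leadingCoeff, hcoeff, ← map_mul, Ne, Ideal.Quotient.eq_zero_iff_mem, mul_comm]
    intro hmem
    apply Polynomial.leadingCoeff_ne_zero.2 hA
    rw [Polynomial.leadingCoeff, hcoeff, Ideal.Quotient.eq_zero_iff_mem]
    exact hT _ hmem
  have hTn : (ψ T).coeff (T.degreeOf i) = Ideal.Quotient.mk J (lcv i T) := hcoeff _ _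
  have hTdeg : (ψ T).natDegree = T.degreeOf i := by
    refine le_antisymm (hdeg T) (Polynomial.le_natDegree_of_ne_zero ?_)
    rw [hTn]
    exact right_ne_zero_of_mul hlc
  have := Polynomial.natDegree_mul' (p := ψ A) (q := ψ T)
    (by rwa [show (ψ T).leadingCoeff = (ψ T).coeff (ψ T).natDegree from rfl, hTdeg, hTn])
  rw [← hmul, hTdeg] at this
  have := hdeg R
  omega

theorem premTS_eq_zero_iff_mem_paramSat {V : Set (Fin n)} (L : List (MvPolynomial (Fin n) K))
    (hL : ∀ T ∈ L, 0 < cls T) (hpw : L.Pairwise fun A B => cls A < cls B)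
    (hreg : ∀ j : ℕ, 0 < j → j < L.length → resTS (ini (L.getD j 0)) (L.take j) ≠ 0)
    (hV : Dominates V L) (P : MvPolynomial (Fin n) K) :
    premTS P L = 0 ↔ P ∈ paramSat V L := by
  induction L using List.reverseRecOn generalizing P with
  | nil =>
    constructor
    · intro h
      rw [show P = 0 from h]
      exact Ideal.zero_mem _
    · rintro ⟨d, -, hd0, hdP⟩
      simpa [premTS, hd0] using hdP
  | append_singleton L T ih =>
    have hTpos : 0 < cls T := hL T (by simp)
    obtain ⟨i, hi, hdeg, hini, hprem, -⟩ := exists_leading_var hTpos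
    rw [List.pairwise_append] at hpw
    have hlt : ∀ S ∈ L, cls S < cls T := fun S hS => hpw.2.2 S hS T (by simp)
    have hLpos : ∀ S ∈ L, 0 < cls S := fun S hS => hL S (by simp [hS])
    have hVL := hV.of_append_singleton hTpos hlt
    have hiV : i ∈ V := hV.1 ⟨T, by simp, hi⟩
    specialize ih hLpos hpw.1 (fun j hj hjl => by
      have := hreg j hj (by simp; omega)
      rwa [List.getD_append _ _ _ _ hjl, List.take_append_of_le_length hjl.le] at this) hVL
    have hT0 : T ≠ 0 := by
      rintro rfl
      simp at hdeg
    set r := resTS (lcv i T) L with hr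
    have hr0 : r ≠ 0 := by
      rcases Nat.eq_zero_or_pos L.length with h0 | h0
      · rw [List.length_eq_zero_iff.1 h0] at hr
        exact hr ▸ lcv_ne_zero i hT0
      · simpa [hini] using hreg L.length h0 (by simp)
    have hrV : r ∈ supported K Vᶜ := by
      refine resTS_mem_supported L hLpos hpw.1 hVL ?_
      have hT := hV.mem_supported (T := T) (by simp)
      rw [leadVars_append_singleton L hi] at hT
      exact supported_mono (insert_diff_subset _ _ i) (coefv_mem_supported i _ hT)
    have hrL : r ∈ Ideal.span (insert (lcv i T) {S | S ∈ L}) := resTS_mem_span L hLpos _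
    have hsub : L ⊆ L ++ [T] := List.subset_append_left _ _
    have hrLT : r ∈ Ideal.span (insert (lcv i T) {S | S ∈ L ++ [T]}) :=
      Ideal.span_mono (Set.insert_subset_insert fun S hS => hsub hS) hrL
    have hTmem : T ∈ paramSat V (L ++ [T]) := span_le_paramSat V _ (Ideal.subset_span (by simp))
    have hstep : premTS P (L ++ [T]) = premTS (prem P T i) L := by
      simp [premTS, hprem]
    obtain ⟨q, A, hA⟩ := exists_lcv_pow_mul_eq i hdeg P
    rw [hstep, ih]
    constructor
    · intro h
      have hmem : lcv i T ^ q * P ∈ paramSat V (L ++ [T]) := by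
        rw [hA]
        exact Ideal.add_mem _ (Ideal.mul_mem_left _ _ hTmem) (paramSat_mono V hsub h)
      clear hA
      induction q with
      | zero => simpa using hmem
      | succ q ihq =>
        refine ihq (mem_paramSat_of_mul_mem_of_mem_span hrV hr0 hrLT ?_)
        rwa [← mul_assoc, ← pow_succ']
    · intro h
      have hmem : prem P T i ∈ paramSat V (L ++ [T]) := by
        rw [show prem P T i = lcv i T ^ q * P - A * T by rw [hA]; ring]
        exact Ideal.sub_mem _ (Ideal.mul_mem_left _ _ h) (Ideal.mul_mem_left _ _ hTmem)
      obtain ⟨d, hd, hd0, hdP⟩ := hmem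
      refine mem_paramSat_of_mul_mem hd hd0 ?_
      have hset : {S | S ∈ L ++ [T]} = insert T {S | S ∈ L} := by
        ext S
        simp [or_comm]
      rw [hset] at hdP
      obtain ⟨B, z, hz, hBz⟩ := Ideal.mem_span_insert.1 hdP
      have hLi : ∀ S ∈ L, S ∈ supported K ({i}ᶜ : Set (Fin n)) := fun S hS => by
        rw [MvPolynomial.mem_supported]
        rintro v hv rfl
        have := lt_cls_of_mem_vars hv
        have := hlt S hS
        omega
      refine mem_of_sub_mul_mem_of_degreeOf_lt (i := i) (T := T) (A := B)
        (fun Q hQ e => coefv_mem_paramSat hiV hLi hQ e)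
        (fun a ha => mem_paramSat_of_mul_mem_of_mem_span hrV hr0 hrL ha) ?_ ?_
      · refine (degreeOf_mul_le _ _ _).trans_lt ?_
        rw [degreeOf_eq_zero_of_mem_supported (by simpa using hiV) hd, zero_add]
        exact degreeOf_prem_lt i hdeg P
      · rw [hBz, add_sub_cancel_left]
        exact span_le_paramSat V L hz

/-- Let `T` be a regular set and `P`, `F` two polynomials. If
`prem(P, T) = 0` and `prem(F, T) = 0`, then `prem(P + F, T) = 0`. -/
theorem statement4 {n : ℕ} {K : Type*} [Field K] (L : List (MvPolynomial (Fin n) K))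
    (hreg : RegularSet L) (P F : MvPolynomial (Fin n) K)
    (hP : premTS P L = 0) (hF : premTS F L = 0) :
    premTS (P + F) L = 0 := by
  have hpw : L.Pairwise fun A B => cls A < cls B := by
    have : IsTrans (MvPolynomial (Fin n) K) fun A B => cls A < cls B :=
      ⟨fun _ _ _ => lt_trans⟩
    exact List.isChain_iff_pairwise.1 hreg.1.2.2
  have key := premTS_eq_zero_iff_mem_paramSat L hreg.1.2.1 hpw hreg.2
    (V := leadVars L) ⟨subset_rfl, fun v hv => Or.inl hv⟩
  rw [key] at hP hF ⊢
  exact Ideal.add_mem _ hP hF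

end CharSets
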